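/- Theorem B.1 (measurable Gale-Stewart strategies): Let 𝒳_t (t ≥ 1) be Polish spaces and 𝒴_t (t ≥ 1) be countable sets, and consider the infinite game with set 𝖶 ⊆ Π_{t≥1}(𝒳_t × 𝒴_t) of winning sequences for P_L. If 𝖶 is finitely decidable and coanalytic, then either P_A has a winning strategy, or P_L has a winning strategy given by maps g_t : Π_{s<t}(𝒳_s × 𝒴_s) × 𝒳_t → 𝒴_t each of which is universally measurable. -/

import Mathlib

universe u

/-- A function is universally measurable if it is measurable with respect to (the completion of)
every Borel probability measure on its domain. -/
def UniversallyMeasurable {α β : Type*} [MeasurableSpace α] [MeasurableSpace β] (f : α → β) : Prop :=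
  ∀ μ : MeasureTheory.Measure α, MeasureTheory.IsProbabilityMeasure μ →
    MeasureTheory.NullMeasurable f μ

variable {X Y : ℕ → Type u}

/-- `𝖶` is finitely decidable: membership of a sequence in `𝖶` is witnessed by a finite
prefix. -/
def FinitelyDecidable (W : Set (∀ t : ℕ, X t × Y t)) : Prop :=
  ∀ w ∈ W, ∃ n : ℕ, ∀ w' : ∀ t : ℕ, X t × Y t, (∀ t < n, w' t = w t) → w' ∈ W

/-- The strategy `f` for player `P_A` (mapping the current position to the next move of `P_A`)
is winning: every infinite play consistent with `f` lies outside `𝖶`. -/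
def WinningForPA (W : Set (∀ t : ℕ, X t × Y t))
    (f : ∀ t : ℕ, (∀ s : Fin t, X s.val × Y s.val) → X t) : Prop :=
  ∀ (x : ∀ t : ℕ, X t) (y : ∀ t : ℕ, Y t),
    (∀ t : ℕ, x t = f t fun s : Fin t => (x s.val, y s.val)) →
    (fun t => (x t, y t)) ∉ W

/-- The strategy `g` for player `P_L` (mapping the current position and the last move of `P_A`
to the next move of `P_L`) is winning: every infinite play consistent with `g` lies in `𝖶`. -/
def WinningForPL (W : Set (∀ t : ℕ, X t × Y t))
    (g : ∀ t : ℕ, (∀ s : Fin t, X s.val × Y s.val) → X t → Y t) : Prop :=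
  ∀ (x : ∀ t : ℕ, X t) (y : ∀ t : ℕ, Y t),
    (∀ t : ℕ, y t = g t (fun s : Fin t => (x s.val, y s.val)) (x t)) →
    (fun t => (x t, y t)) ∈ W

/-! ### Analytic sets are universally measurable -/

section AnalyticMeasurability

open MeasureTheory Set Filter Topology

/-- The sequences whose first `k` entries are bounded by those of `b`. -/
def boundedUpTo (b : ℕ → ℕ) (k : ℕ) : Set (ℕ → ℕ) := {x | ∀ i < k, x i ≤ b i}

theorem boundedUpTo_succ (b : ℕ → ℕ) (k : ℕ) :
    boundedUpTo b (k + 1) = boundedUpTo b k ∩ {x | x k ≤ b k} := by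
  ext x
  exact Nat.forall_lt_succ_right

theorem isCompact_setOf_le (b : ℕ → ℕ) : IsCompact {x : ℕ → ℕ | ∀ i, x i ≤ b i} := by
  have : {x : ℕ → ℕ | ∀ i, x i ≤ b i} = univ.pi fun i => Iic (b i) := by
    ext x
    exact mem_univ_pi.symm
  rw [this]
  exact isCompact_univ_pi fun i => (finite_Iic (b i)).isCompact

theorem exists_boundedUpTo_subset {b : ℕ → ℕ} {O : Set (ℕ → ℕ)} (hO : IsOpen O)
    (hb : {x : ℕ → ℕ | ∀ i, x i ≤ b i} ⊆ O) : ∃ k, boundedUpTo b k ⊆ O := by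
  by_contra! hcon
  simp only [not_subset] at hcon
  choose x hx hxO using hcon
  obtain ⟨a, ha, φ, hφ, hlim⟩ := (isCompact_setOf_le b).tendsto_subseq
    (x := fun k i => min (x k i) (b i)) (fun k i => min_le_right _ _)
  refine hO.isClosed_compl.mem_of_tendsto (f := fun k => x (φ k)) (b := atTop) (x := a) ?_
    (Eventually.of_forall fun k => hxO _) (hb ha)
  rw [tendsto_pi_nhds] at hlim ⊢
  refine fun i => (hlim i).congr' ?_
  filter_upwards [hφ.tendsto_atTop.eventually_gt_atTop i] with k hk
  simpa using hx _ _ hk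

variable {α : Type*} [MeasurableSpace α]

theorem exists_lt_measure_image_boundedUpTo {μ : Measure α} {f : (ℕ → ℕ) → α} {r : ENNReal}
    (hr : r < μ (range f)) : ∃ b : ℕ → ℕ, ∀ k, r < μ (f '' boundedUpTo b k) := by
  have step (k : ℕ) (C : Set (ℕ → ℕ)) (hC : r < μ (f '' C)) :
      ∃ m, r < μ (f '' (C ∩ {x | x k ≤ m})) := by
    have hmono : Monotone fun m => f '' (C ∩ {x | x k ≤ m}) := fun m n hmn =>
      image_mono (inter_subset_inter_right _ fun x (hx : x k ≤ m) => hx.trans hmn)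
    have hU : f '' C = ⋃ m, f '' (C ∩ {x | x k ≤ m}) := by
      rw [← image_iUnion, ← inter_iUnion]
      congr 1
      exact (inter_eq_left.2 fun x _ => mem_iUnion.2 ⟨x k, le_refl (x k)⟩).symm
    rw [hU, hmono.measure_iUnion] at hC
    exact lt_iSup_iff.1 hC
  choose! m hm using step
  let C : ℕ → Set (ℕ → ℕ) := fun n => Nat.rec univ (fun k D => D ∩ {x | x k ≤ m k D}) n
  have hC : ∀ k, boundedUpTo (fun i => m i (C i)) k = C k := by
    intro k
    induction k with
    | zero => simp [boundedUpTo, C]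
    | succ k ih => rw [boundedUpTo_succ, ih]
  refine ⟨fun i => m i (C i), fun k => ?_⟩
  rw [hC]
  induction k with
  | zero => simpa [C] using hr
  | succ k ih => exact hm k _ ih

variable [TopologicalSpace α] [PolishSpace α] [BorelSpace α]

theorem exists_isCompact_subset_range_le_measure (μ : Measure α) [IsFiniteMeasure μ]
    {f : (ℕ → ℕ) → α} (hf : Continuous f) {r : ENNReal} (hr : r < μ (range f)) :
    ∃ K ⊆ range f, IsCompact K ∧ r ≤ μ K := by
  obtain ⟨b, hb⟩ := exists_lt_measure_image_boundedUpTo hr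
  refine ⟨f '' {x | ∀ i, x i ≤ b i}, image_subset_range _ _, (isCompact_setOf_le b).image hf, ?_⟩
  rw [Set.measure_eq_iInf_isOpen]
  refine le_iInf₂ fun U hKU => le_iInf fun hU => ?_
  obtain ⟨k, hk⟩ := exists_boundedUpTo_subset (hU.preimage hf) (image_subset_iff.1 hKU)
  exact (hb k).le.trans (measure_mono (image_subset_iff.2 hk))

/-- Analytic subsets of a Polish space are universally measurable. -/
theorem analyticSet_nullMeasurableSet {s : Set α} (hs : AnalyticSet s) (μ : Measure α)
    [IsFiniteMeasure μ] : NullMeasurableSet s μ := by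
  rw [AnalyticSet] at hs
  obtain rfl | ⟨f, hf, rfl⟩ := hs
  · exact nullMeasurableSet_empty
  obtain h0 | hpos := eq_zero_or_pos (μ (range f))
  · exact NullMeasurableSet.of_null h0
  obtain ⟨u, -, hu, hlim⟩ := exists_seq_strictMono_tendsto' hpos
  choose K hKs hK hle using fun n => exists_isCompact_subset_range_le_measure μ hf (hu n).2
  have hmeas : MeasurableSet (⋃ n, K n) := .iUnion fun n => (hK n).measurableSet
  refine hmeas.nullMeasurableSet.congr (ae_eq_of_subset_of_measure_ge (iUnion_subset hKs) ?_
    hmeas.nullMeasurableSet (measure_ne_top _ _))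
  exact le_of_tendsto' hlim fun n => (hle n).trans (measure_mono (subset_iUnion K n))

end AnalyticMeasurability

/-! ### Comparing ranks of relations -/

section RelationRank

open Classical in
/-- The rank of `a` with respect to `r`, with value `⊤` outside the well-founded part of `r`. -/
noncomputable def relRank {α : Type*} (r : α → α → Prop) (a : α) : WithTop Ordinal :=
  if h : Acc r a then (h.rank : WithTop Ordinal) else ⊤

variable {α β : Type*} {r : α → α → Prop} {r' : β → β → Prop}

theorem relRank_of_acc {a : α} (h : Acc r a) : relRank r a = h.rank := dif_pos h

theorem relRank_eq_top_iff {a : α} : relRank r a = ⊤ ↔ ¬ Acc r a := by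
  unfold relRank
  split_ifs with h <;> simp [h]

theorem relRank_lt_of_rel {a b : α} (hb : relRank r b ≠ ⊤) (h : r a b) :
    relRank r a < relRank r b := by
  have hb' : Acc r b := not_not.1 (mt relRank_eq_top_iff.2 hb)
  rw [relRank_of_acc hb', relRank_of_acc (hb'.inv h)]
  exact_mod_cast Acc.rank_lt_of_rel hb' h

/-- A set of pairs that is closed under matching steps of `r` by steps of `r'`. -/
def IsSimulation (r : α → α → Prop) (r' : β → β → Prop) (Z : α → β → Prop) : Prop :=
  ∀ a b, Z a b → ∀ c, r c a → ∃ d, r' d b ∧ Z c d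

end RelationRank

section RelationRankComparison

variable {α β : Type u} {r : α → α → Prop} {r' : β → β → Prop}

theorem IsSimulation.relRank_le {Z : α → β → Prop} (hZ : IsSimulation r r' Z) {a : α} {b : β}
    (h : Z a b) : relRank r a ≤ relRank r' b := by
  by_cases hb : Acc r' b
  swap
  · rw [relRank_eq_top_iff.2 hb]
    exact le_top
  induction hb generalizing a with
  | intro b hb ih =>
    have key (c : α) (hc : r c a) : ∃ d, ∃ hd : r' d b, relRank r c ≤ relRank r' d := by
      obtain ⟨d, hd, hcd⟩ := hZ a b h c hc
      exact ⟨d, hd, ih d hd hcd⟩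
    have hacc : ∀ c, r c a → Acc r c := by
      intro c hc
      obtain ⟨d, hd, hcd⟩ := key c hc
      by_contra hn
      rw [relRank_eq_top_iff.2 hn, top_le_iff, relRank_eq_top_iff] at hcd
      exact hcd (hb d hd)
    rw [relRank_of_acc (Acc.intro a hacc), relRank_of_acc (Acc.intro b hb), WithTop.coe_le_coe,
      Acc.rank_eq]
    refine Ordinal.iSup_le fun ⟨c, hc⟩ => Order.succ_le_of_lt ?_
    obtain ⟨d, hd, hcd⟩ := key c hc
    rw [relRank_of_acc (hacc c hc), relRank_of_acc (hb d hd), WithTop.coe_le_coe] at hcd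
    exact hcd.trans_lt (Acc.rank_lt_of_rel (Acc.intro b hb) hd)

theorem isSimulation_relRank_le :
    IsSimulation r r' fun a b => relRank r a ≤ relRank r' b := by
  intro a b hab c hc
  by_cases hb : Acc r' b
  · have ha : Acc r a := by
      by_contra ha
      rw [relRank_eq_top_iff.2 ha, top_le_iff, relRank_eq_top_iff] at hab
      exact hab hb
    rw [relRank_of_acc ha, relRank_of_acc hb, WithTop.coe_le_coe] at hab
    have hlt := (ha.rank_lt_of_rel hc).trans_le hab
    rw [hb.rank_eq, Ordinal.lt_iSup_iff] at hlt
    obtain ⟨⟨d, hd⟩, hlt⟩ := hlt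
    refine ⟨d, hd, ?_⟩
    beta_reduce
    rw [relRank_of_acc (ha.inv hc), relRank_of_acc (hb.inv hd), WithTop.coe_le_coe]
    exact Order.lt_succ_iff.1 hlt
  · have : ∃ d, r' d b ∧ ¬ Acc r' d := by
      by_contra! hcon
      exact hb (Acc.intro b hcon)
    obtain ⟨d, hd, hnd⟩ := this
    refine ⟨d, hd, ?_⟩
    exact le_top.trans_eq (relRank_eq_top_iff.2 hnd).symm

theorem relRank_le_iff {a : α} {b : β} :
    relRank r a ≤ relRank r' b ↔ ∃ Z, IsSimulation r r' Z ∧ Z a b :=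
  ⟨fun h => ⟨_, isSimulation_relRank_le, h⟩, fun ⟨_, hZ, h⟩ => hZ.relRank_le h⟩

open MeasureTheory in
/-- For two measurable families of relations on countable types, comparing the ranks of two
elements is an analytic condition on the parameter. -/
theorem analyticSet_setOf_relRank_le {Ω : Type*} [TopologicalSpace Ω] [PolishSpace Ω]
    [MeasurableSpace Ω] [BorelSpace Ω] [Countable α] [Countable β]
    {R : Ω → α → α → Prop} {R' : Ω → β → β → Prop}
    (hR : ∀ a b, MeasurableSet {ω | R ω a b}) (hR' : ∀ a b, MeasurableSet {ω | R' ω a b})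
    (a : α) (b : β) : AnalyticSet {ω | relRank (R ω) a ≤ relRank (R' ω) b} := by
  have hS : MeasurableSet {p : Ω × (α × β → Bool) |
      IsSimulation (R p.1) (R' p.1) (fun a b => p.2 (a, b)) ∧ p.2 (a, b)} := by
    have hZ (a : α) (b : β) : Measurable fun p : Ω × (α × β → Bool) => p.2 (a, b) = true := by
      have : Measurable fun p : Ω × (α × β → Bool) => p.2 (a, b) :=
        (measurable_pi_apply (a, b)).comp measurable_snd
      exact measurableSet_setOfPred.1 (this (measurableSet_singleton true))
    have h1 (a b : α) : Measurable fun p : Ω × (α × β → Bool) => R p.1 a b :=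
      (measurableSet_setOfPred.1 (hR a b)).comp measurable_fst
    have h2 (a b : β) : Measurable fun p : Ω × (α × β → Bool) => R' p.1 a b :=
      (measurableSet_setOfPred.1 (hR' a b)).comp measurable_fst
    refine measurableSet_setOfPred.2 (Measurable.and ?_ (hZ a b))
    exact .forall fun a => .forall fun b => (hZ a b).imp <| .forall fun c => (h1 c a).imp <|
      .exists fun d => (h2 d b).and (hZ c d)
  convert! hS.analyticSet_image measurable_fst
  ext ω
  classical
  simp only [Set.mem_ofPred_eq, relRank_le_iff, Set.mem_image, Prod.exists, exists_and_right,
    exists_eq_right]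
  constructor
  · rintro ⟨Z, hZ, hab⟩
    exact ⟨fun q => decide (Z q.1 q.2), by simpa using hZ, by simpa using hab⟩
  · rintro ⟨Z, hZ, hab⟩
    exact ⟨_, hZ, hab⟩

end RelationRankComparison

/-! ### Coding the game by trees on `ℕ` -/

section Game

open MeasureTheory Set Filter Topology PiNat

/-- The positions of the game after `n` rounds. -/
abbrev Position (X Y : ℕ → Type u) (n : ℕ) : Type u := ∀ s : Fin n, X s.val × Y s.val

/-- The position reached by an infinite play after `n` rounds. -/
def Position.ofPlay (w : ∀ t, X t × Y t) (n : ℕ) : Position X Y n := fun s => w s.val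

/-- The position obtained by playing one more round. -/
def Position.snoc {n : ℕ} (v : Position X Y n) (m : X n × Y n) : Position X Y (n + 1) :=
  Fin.snoc (α := fun s : Fin (n + 1) => X s.val × Y s.val) v m

theorem Position.snoc_ofPlay (w : ∀ t, X t × Y t) (n : ℕ) :
    (Position.ofPlay w n).snoc (w n) = Position.ofPlay w (n + 1) := by
  funext s
  induction s using Fin.lastCases with
  | last => exact Fin.snoc_last (α := fun s : Fin (n + 1) => X s.val × Y s.val) _ _
  | cast i => exact Fin.snoc_castSucc (α := fun s : Fin (n + 1) => X s.val × Y s.val) _ _ _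

/-- The `i`-th of the countably many sequences coded by `σ`; its entries below `k` are determined
by the entries of `σ` below `k + 1`. -/
def codePart (i : ℕ) (σ : ℕ → ℕ) : ℕ → ℕ := fun c => σ (Nat.pair i c + 1)

/-- Codes countably many sequences by a single one. -/
def codeJoin (p : ℕ → ℕ → ℕ) : ℕ → ℕ
  | 0 => 0
  | c + 1 => p (Nat.unpair c).1 (Nat.unpair c).2

theorem codePart_codeJoin (i : ℕ) (p : ℕ → ℕ → ℕ) : codePart i (codeJoin p) = p i := by
  funext c
  simp [codePart, codeJoin]

theorem continuous_codePart (i : ℕ) : Continuous (codePart i) :=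
  continuous_pi fun _ => continuous_apply _

theorem res_codeJoin_congr {p q : ℕ → ℕ → ℕ} {k : ℕ} (h : ∀ i, res (p i) k = res (q i) k) :
    res (codeJoin p) (k + 1) = res (codeJoin q) (k + 1) := by
  rw [res_eq_res]
  rintro (_ | c) hc
  · rfl
  · exact res_eq_res.1 (h _) ((Nat.unpair_right_le c).trans_lt (by omega))

/-- In a metrizable space, points are separated by a sequence of closed neighbourhoods of the
diagonal. -/
theorem exists_isOpen_nhds_diagonal (α : Type*) [TopologicalSpace α]
    [TopologicalSpace.MetrizableSpace α] :
    ∃ U : ℕ → Set (α × α), (∀ b, IsOpen (U b)) ∧ (∀ b a, (a, a) ∈ U b) ∧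
      ∀ a a', (∀ b, (a, a') ∈ closure (U b)) → a = a' := by
  let := TopologicalSpace.metrizableSpaceMetric α
  refine ⟨fun b => {p | dist p.1 p.2 < 1 / ((b : ℝ) + 1)}, fun b =>
    isOpen_lt (by fun_prop) continuous_const, fun b a => ?_, fun a a' h => ?_⟩
  · simpa using Nat.cast_add_one_pos b
  · have hle : ∀ b : ℕ, dist a a' ≤ 1 / ((b : ℝ) + 1) := fun b =>
      closure_minimal (t := {p : α × α | dist p.1 p.2 ≤ 1 / ((b : ℝ) + 1)})
        (fun p (hp : dist p.1 p.2 < _) => hp.le)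
        (isClosed_le (by fun_prop) continuous_const) (h b)
    exact dist_le_zero.1 (ge_of_tendsto' tendsto_one_div_add_atTop_nhds_zero_nat hle)

/-- The child relation of a tree of finite sequences, which are listed from the last entry. -/
def TreeChild (T : Set (List ℕ)) (t s : List ℕ) : Prop := t ∈ T ∧ ∃ a, t = a :: s

variable [∀ t, TopologicalSpace (X t)] [∀ t, TopologicalSpace (Y t)]

theorem Position.continuous_ofPlay (n : ℕ) :
    Continuous fun w : ∀ t, X t × Y t => Position.ofPlay w n :=
  continuous_pi fun _ => continuous_apply _

theorem Position.continuous_snoc (n : ℕ) :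
    Continuous fun p : Position X Y n × (X n × Y n) => p.1.snoc p.2 :=
  Continuous.finSnoc (A := fun s : Fin (n + 1) => X s.val × Y s.val) continuous_fst continuous_snd

/-- Parametrizations of the moves of both players, together with a parametrization `escape` of the
plays won by `P_A`, by sequences of natural numbers. -/
structure GameCoding (X Y : ℕ → Type u) [∀ t, TopologicalSpace (X t)]
    [∀ t, TopologicalSpace (Y t)] where
  /-- Parametrization of the moves of `P_A`. -/
  move : ∀ t, (ℕ → ℕ) → X t
  continuous_move : ∀ t, Continuous (move t)
  surjective_move : ∀ t, Function.Surjective (move t)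
  /-- Enumeration of the moves of `P_L`. -/
  reply : ∀ t, ℕ → Y t
  surjective_reply : ∀ t, Function.Surjective (reply t)
  /-- Parametrization of the plays won by `P_A`. -/
  escape : (ℕ → ℕ) → ∀ t, X t × Y t
  continuous_escape : Continuous escape
  /-- Neighbourhoods of the diagonal in the spaces of positions. -/
  nbhd : ∀ n, ℕ → Set (Position X Y n × Position X Y n)
  isOpen_nbhd : ∀ n b, IsOpen (nbhd n b)
  diag_mem_nbhd : ∀ n b v, (v, v) ∈ nbhd n b
  eq_of_mem_closure_nbhd : ∀ n v v', (∀ b, (v, v') ∈ closure (nbhd n b)) → v = v'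

namespace GameCoding

variable (C : GameCoding X Y)

/-- A sequence of conditions expressing in the limit that `σ` codes a strategy of `P_A` from the
position `v` such that all positions it reaches are initial segments of plays won by `P_A`. -/
def Condition : ℕ → ∀ n, Position X Y n → (ℕ → ℕ) → Prop
  | 0, _, _, _ => True
  | j + 1, n, v, σ =>
    match (Nat.unpair j).1 with
    | 0 => (Position.ofPlay (C.escape (codePart 1 σ)) n, v) ∈ C.nbhd n (Nat.unpair j).2
    | i + 1 => Condition (Nat.unpair j).2 (n + 1)
        (v.snoc (C.move n (codePart 0 σ), C.reply n i)) (codePart (i + 2) σ)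
termination_by j => j
decreasing_by exact Nat.lt_succ_of_le (Nat.unpair_right_le j)

variable {n : ℕ} {v : Position X Y n} {σ : ℕ → ℕ}

theorem condition_zero : C.Condition 0 n v σ := by
  rw [Condition]
  trivial

theorem condition_pair_zero {b : ℕ} : C.Condition (Nat.pair 0 b + 1) n v σ ↔
    (Position.ofPlay (C.escape (codePart 1 σ)) n, v) ∈ C.nbhd n b := by
  rw [Condition, Nat.unpair_pair]

theorem condition_pair_succ {i b : ℕ} : C.Condition (Nat.pair (i + 1) b + 1) n v σ ↔
    C.Condition b (n + 1) (v.snoc (C.move n (codePart 0 σ), C.reply n i)) (codePart (i + 2) σ) := by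
  rw [Condition, Nat.unpair_pair]

theorem eq_zero_or_pair (j : ℕ) :
    j = 0 ∨ (∃ b, j = Nat.pair 0 b + 1) ∨ ∃ i b, b < j ∧ j = Nat.pair (i + 1) b + 1 := by
  rcases j with _ | j
  · exact .inl rfl
  · refine .inr ?_
    rw [← Nat.pair_unpair j]
    rcases h : (Nat.unpair j).1 with _ | i
    · exact .inl ⟨_, rfl⟩
    · exact .inr ⟨i, _, Nat.lt_succ_of_le (Nat.right_le_pair _ _), rfl⟩

theorem continuous_step (n i : ℕ) : Continuous fun p : Position X Y n × (ℕ → ℕ) =>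
    (p.1.snoc (C.move n (codePart 0 p.2), C.reply n i), codePart (i + 2) p.2) := by
  refine Continuous.prodMk ((Position.continuous_snoc n).comp (continuous_fst.prodMk
    (Continuous.prodMk ?_ continuous_const))) ((continuous_codePart _).comp continuous_snd)
  exact (C.continuous_move n).comp ((continuous_codePart 0).comp continuous_snd)

theorem continuous_witness (n : ℕ) : Continuous fun p : Position X Y n × (ℕ → ℕ) =>
    (Position.ofPlay (C.escape (codePart 1 p.2)) n, p.1) :=
  ((Position.continuous_ofPlay n).comp (C.continuous_escape.comp
    ((continuous_codePart 1).comp continuous_snd))).prodMk continuous_fst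

theorem isOpen_condition (j n : ℕ) :
    IsOpen {p : Position X Y n × (ℕ → ℕ) | C.Condition j n p.1 p.2} := by
  induction j using Nat.strong_induction_on generalizing n with
  | _ j ih =>
    obtain rfl | ⟨b, rfl⟩ | ⟨i, b, hb, rfl⟩ := eq_zero_or_pair j
    · simp [condition_zero]
    · simp only [condition_pair_zero]
      exact (C.isOpen_nbhd n b).preimage (C.continuous_witness n)
    · simp only [condition_pair_succ]
      exact (ih b hb (n + 1)).preimage (C.continuous_step n i)

/-- The tree of finite approximations to a code of a winning strategy of `P_A` from `v`. -/
def tree (n : ℕ) (v : Position X Y n) : Set (List ℕ) :=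
  {s | ∃ σ : ℕ → ℕ, res σ s.length = s ∧ ∀ j < s.length, C.Condition j n v σ}

theorem res_mem_tree {k : ℕ} (h : ∀ j < k, C.Condition j n v σ) : res σ k ∈ C.tree n v :=
  ⟨σ, by rw [res_length], by rwa [res_length]⟩

theorem isOpen_setOf_mem_tree (n : ℕ) (s : List ℕ) :
    IsOpen {v : Position X Y n | s ∈ C.tree n v} := by
  have : {v : Position X Y n | s ∈ C.tree n v} = ⋃ σ ∈ {σ : ℕ → ℕ | res σ s.length = s},
      ⋂ j ∈ Finset.range s.length, {v | C.Condition j n v σ} := by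
    ext v
    simp [tree]
  rw [this]
  exact isOpen_biUnion fun σ _ => isOpen_biInter_finset fun j _ =>
    (C.isOpen_condition j n).preimage (.prodMk_left σ)

/-- The rank of the tree of attempts of `P_A` to win from `v`. -/
noncomputable def rank (n : ℕ) (v : Position X Y n) : WithTop Ordinal.{0} :=
  relRank (TreeChild (C.tree n v)) []

/-- The pair of a position and a code of a strategy is a limit of pairs satisfying more and more
of the conditions. -/
def IsWinningCode (n : ℕ) (v : Position X Y n) (σ : ℕ → ℕ) : Prop :=
  ∃ q : ℕ → Position X Y n × (ℕ → ℕ), Tendsto q atTop (𝓝 (v, σ)) ∧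
    ∀ j, ∀ᶠ k in atTop, C.Condition j n (q k).1 (q k).2

variable {C}

theorem IsWinningCode.ofPlay_escape (h : C.IsWinningCode n v σ) :
    Position.ofPlay (C.escape (codePart 1 σ)) n = v := by
  obtain ⟨q, hq, hcond⟩ := h
  refine C.eq_of_mem_closure_nbhd n _ _ fun b => ?_
  refine mem_closure_of_tendsto (((C.continuous_witness n).tendsto _).comp hq) ?_
  filter_upwards [hcond (Nat.pair 0 b + 1)] with k hk
  exact C.condition_pair_zero.1 hk

theorem IsWinningCode.snoc (h : C.IsWinningCode n v σ) (i : ℕ) :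
    C.IsWinningCode (n + 1) (v.snoc (C.move n (codePart 0 σ), C.reply n i)) (codePart (i + 2) σ) := by
  obtain ⟨q, hq, hcond⟩ := h
  refine ⟨_, ((C.continuous_step n i).tendsto _).comp hq, fun b => ?_⟩
  filter_upwards [hcond (Nat.pair (i + 1) b + 1)] with k hk
  exact C.condition_pair_succ.1 hk

theorem exists_isWinningCode_of_rank_eq_top (h : C.rank n v = ⊤) : ∃ σ, C.IsWinningCode n v σ := by
  rw [rank, relRank_eq_top_iff, not_acc_iff_exists_descending_chain] at h
  obtain ⟨c, hc0, hc⟩ := h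
  choose hmem σ hσ using hc
  have hres (k : ℕ) : c k = res σ k := by
    induction k with
    | zero => exact hc0
    | succ k ih => rw [hσ, ih, res_succ]
  choose τ hτ hcond using hmem
  refine ⟨σ, fun k => (v, τ k), tendsto_const_nhds.prodMk_nhds ?_, fun j => ?_⟩
  · rw [tendsto_pi_nhds]
    intro m
    refine tendsto_const_nhds.congr' ?_
    filter_upwards [eventually_gt_atTop m] with k hk
    have := hτ k
    rw [hres, res_length, res_eq_res] at this
    exact (this (by omega)).symm
  · filter_upwards [eventually_gt_atTop j] with k hk
    refine hcond k j ?_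
    rw [hres, res_length]
    omega

/-- If `P_A` can win from `v` with the cooperation of `P_L`, then after every move of `P_A` some
reply of `P_L` decreases the rank. -/
theorem rank_snoc_lt {z : ℕ → ℕ} (hz : Position.ofPlay (C.escape z) n = v) (hv : C.rank n v ≠ ⊤)
    (x : X n) (i₀ : ℕ) (hmin : ∀ i, C.rank (n + 1) (v.snoc (x, C.reply n i₀)) ≤
      C.rank (n + 1) (v.snoc (x, C.reply n i))) :
    C.rank (n + 1) (v.snoc (x, C.reply n i₀)) < C.rank n v := by
  obtain ⟨u, rfl⟩ := C.surjective_move n x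
  set T : ℕ → Set (List ℕ) := fun i => C.tree (n + 1) (v.snoc (C.move n u, C.reply n i))
  let J : (ℕ → ℕ → ℕ) → ℕ → ℕ := fun p =>
    codeJoin fun | 0 => u | 1 => z | i + 2 => p i
  have hJ {p q : ℕ → ℕ → ℕ} {k : ℕ} (h : ∀ i, res (p i) k = res (q i) k) :
      res (J p) (k + 1) = res (J q) (k + 1) := by
    refine res_codeJoin_congr ?_
    rintro (_ | _ | i)
    exacts [rfl, rfl, h i]
  have hJmem {p : ℕ → ℕ → ℕ} {k : ℕ} (h : ∀ i, ∀ j < k,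
      C.Condition j (n + 1) (v.snoc (C.move n u, C.reply n i)) (p i)) :
      res (J p) (k + 1) ∈ C.tree n v := by
    refine C.res_mem_tree fun j hj => ?_
    obtain rfl | ⟨b, rfl⟩ | ⟨i, b, hb, rfl⟩ := eq_zero_or_pair j
    · exact C.condition_zero
    · rw [condition_pair_zero, codePart_codeJoin, hz]
      exact C.diag_mem_nbhd n b v
    · rw [condition_pair_succ, codePart_codeJoin, codePart_codeJoin]
      exact h i b (by omega)
  have hsim : IsSimulation (TreeChild (T i₀)) (TreeChild (C.tree n v)) fun s t =>
      ∃ p : ℕ → ℕ → ℕ, t = res (J p) (s.length + 1) ∧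
        ∀ i, relRank (TreeChild (T i₀)) s ≤ relRank (TreeChild (T i)) (res (p i) s.length) := by
    rintro s _ ⟨p, rfl, hp⟩ c hc
    choose d hd hcd using fun i => isSimulation_relRank_le _ _ (hp i) c hc
    choose hdT a ha using hd
    choose q hq hcond using hdT
    obtain ⟨-, a₀, rfl⟩ := hc
    simp only [ha, List.length_cons, res_length] at hq hcond hcd ⊢
    have hpq (i : ℕ) : res (p i) s.length = res (q i) s.length :=
      (List.cons.inj (hq i)).2.symm
    refine ⟨res (J q) (s.length + 1 + 1), ⟨hJmem hcond, J q (s.length + 1), ?_⟩, q, rfl,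
      fun i => ?_⟩
    · rw [hJ hpq, res_succ]
    · rw [hq]
      exact hcd i
  have hchild : TreeChild (C.tree n v) (res (J fun _ _ => 0) 1) [] :=
    ⟨hJmem (k := 0) (by simp), _, rfl⟩
  exact (hsim.relRank_le ⟨fun _ _ => 0, rfl, hmin⟩).trans_lt (relRank_lt_of_rel hv hchild)

end GameCoding

namespace GameCoding

variable {W : Set (∀ t, X t × Y t)} {C : GameCoding X Y}

theorem exists_winningForPA (hfd : FinitelyDecidable W) (hC : range C.escape = Wᶜ)
    {v₀ : Position X Y 0} (h₀ : C.rank 0 v₀ = ⊤) :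
    ∃ f : ∀ t : ℕ, Position X Y t → X t, WinningForPA W f := by
  classical
  let f (t : ℕ) (v : Position X Y t) : X t :=
    if h : ∃ σ, C.IsWinningCode t v σ then C.move t (codePart 0 h.choose) else C.move t 0
  refine ⟨f, fun x y hx hW => ?_⟩
  set w : ∀ t, X t × Y t := fun t => (x t, y t)
  have hcode (n : ℕ) : ∃ σ, C.IsWinningCode n (Position.ofPlay w n) σ := by
    induction n with
    | zero =>
      rw [Subsingleton.elim (Position.ofPlay w 0) v₀]
      exact exists_isWinningCode_of_rank_eq_top h₀
    | succ n ih =>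
      obtain ⟨i, hi⟩ := C.surjective_reply n (y n)
      have hxn : x n = C.move n (codePart 0 ih.choose) := (hx n).trans (dif_pos ih)
      have := ih.choose_spec.snoc i
      rw [hi, ← hxn] at this
      rw [← Position.snoc_ofPlay]
      exact ⟨_, this⟩
  obtain ⟨n, hn⟩ := hfd w hW
  obtain ⟨σ, hσ⟩ := hcode n
  have hmem : C.escape (codePart 1 σ) ∈ Wᶜ := hC ▸ mem_range_self _
  exact hmem (hn _ fun t ht => congrFun hσ.ofPlay_escape ⟨t, ht⟩)

theorem exists_minimal_reply (C : GameCoding X Y) (n : ℕ) (v : Position X Y n) (x : X n) :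
    ∃ i, ∀ i', C.rank (n + 1) (v.snoc (x, C.reply n i)) ≤
      C.rank (n + 1) (v.snoc (x, C.reply n i')) := by
  obtain ⟨i, -, hi⟩ := exists_minimalFor_of_wellFoundedLT (fun _ : ℕ => True)
    (fun i => C.rank (n + 1) (v.snoc (x, C.reply n i))) ⟨0, trivial⟩
  exact ⟨i, fun i' => (le_total _ _).elim id (hi trivial)⟩

open Classical in
/-- The strategy of `P_L` that plays the first reply of minimal rank. -/
noncomputable def minimalReply (C : GameCoding X Y) (n : ℕ) (v : Position X Y n) (x : X n) : Y n :=
  C.reply n (Nat.find (C.exists_minimal_reply n v x))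

theorem winningForPL_minimalReply (hC : range C.escape = Wᶜ)
    (h₀ : ∀ v : Position X Y 0, C.rank 0 v ≠ ⊤) : WinningForPL W C.minimalReply := by
  classical
  intro x y hy
  by_contra hW
  set w : ∀ t, X t × Y t := fun t => (x t, y t)
  obtain ⟨z, hz⟩ : w ∈ range C.escape := hC ▸ hW
  have hlt (n : ℕ) (hn : C.rank n (Position.ofPlay w n) ≠ ⊤) :
      C.rank (n + 1) (Position.ofPlay w (n + 1)) < C.rank n (Position.ofPlay w n) := by
    have hspec := Nat.find_spec (C.exists_minimal_reply n (Position.ofPlay w n) (x n))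
    have := rank_snoc_lt (by rw [hz]) hn (x n) _ hspec
    have hyn : C.reply n (Nat.find (C.exists_minimal_reply n (Position.ofPlay w n) (x n))) = y n :=
      (hy n).symm
    rwa [hyn, Position.snoc_ofPlay w n] at this
  have htop (n : ℕ) : C.rank n (Position.ofPlay w n) ≠ ⊤ := by
    induction n with
    | zero => exact h₀ _
    | succ n ih => exact (hlt n ih).ne_top
  exact not_strictAnti_of_wellFoundedLT (fun n => C.rank n (Position.ofPlay w n))
    (strictAnti_nat_of_succ_lt fun n => hlt n (htop n))

theorem exists_range_escape_eq [∀ t, PolishSpace (X t)] [∀ t, DiscreteTopology (Y t)]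
    [∀ t, Countable (Y t)] [∀ t, Nonempty (X t)] [∀ t, Nonempty (Y t)]
    {s : Set (∀ t, X t × Y t)} (hs : AnalyticSet s) (hne : s.Nonempty) :
    ∃ C : GameCoding X Y, range C.escape = s := by
  choose move hmove hmove' using fun t =>
    PolishSpace.exists_nat_nat_continuous_surjective (X t)
  choose reply hreply using fun t => exists_surjective_nat (Y t)
  choose U hU hdiag hU' using fun n => exists_isOpen_nhds_diagonal (Position X Y n)
  rw [AnalyticSet] at hs
  obtain rfl | ⟨escape, hescape, rfl⟩ := hs
  · simp at hne
  · exact ⟨⟨move, hmove, hmove', reply, hreply, escape, hescape, U, hU, hdiag, hU'⟩, rfl⟩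

variable [∀ t, PolishSpace (X t)] [∀ t, MeasurableSpace (X t)] [∀ t, BorelSpace (X t)]
  [∀ t, DiscreteTopology (Y t)] [∀ t, Countable (Y t)]
  [∀ t, MeasurableSpace (Y t)] [∀ t, BorelSpace (Y t)]

theorem universallyMeasurable_minimalReply (C : GameCoding X Y) (n : ℕ) :
    UniversallyMeasurable fun q : Position X Y n × X n => C.minimalReply n q.1 q.2 := by
  classical
  intro μ _
  have htree (i : ℕ) (s t : List ℕ) : MeasurableSet {q : Position X Y n × X n |
      TreeChild (C.tree (n + 1) (q.1.snoc (q.2, C.reply n i))) s t} := by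
    refine MeasurableSet.inter ?_ (.const _)
    refine ((C.isOpen_setOf_mem_tree (n + 1) s).preimage ?_).measurableSet
    exact (Position.continuous_snoc n).comp
      (continuous_fst.prodMk (continuous_snd.prodMk continuous_const))
  have hmin (i : ℕ) : NullMeasurableSet {q : Position X Y n × X n | ∀ i',
      C.rank (n + 1) (q.1.snoc (q.2, C.reply n i)) ≤
        C.rank (n + 1) (q.1.snoc (q.2, C.reply n i'))} μ := by
    rw [ofPred_forall]
    exact .iInter fun i' => analyticSet_nullMeasurableSet
      (analyticSet_setOf_relRank_le (htree i) (htree i') _ _) μ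
  exact (measurable_from_nat (f := C.reply n)).comp (measurable_find
    (α := NullMeasurableSpace (Position X Y n × X n) μ)
    (fun q => C.exists_minimal_reply n q.1 q.2) hmin)

end GameCoding

end Game

section EmptyMoves

variable {W : Set (∀ t : ℕ, X t × Y t)}

/-- `P_A` wins when `P_L` has no move in a round that `P_A` can reach. -/
theorem exists_winningForPA_of_isEmpty {n : ℕ} (hY : IsEmpty (Y n)) (hX : ∀ t ≤ n, Nonempty (X t)) :
    ∃ f : ∀ t : ℕ, (∀ s : Fin t, X s.val × Y s.val) → X t, WinningForPA W f := by
  have hf (t : ℕ) (v : ∀ s : Fin t, X s.val × Y s.val) : Nonempty (X t) := by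
    by_contra ht
    exact hY.false (v ⟨n, by by_contra hn; exact ht (hX t (by omega))⟩).2
  exact ⟨fun t v => (hf t v).some, fun _ y => (hY.false (y n)).elim⟩

/-- If the moves of `P_L` do not run out before those of `P_A`, then `P_L` can play the same move
throughout each round; this wins when there are no plays outside `W`. -/
theorem exists_constant_winningForPL [∀ t, MeasurableSpace (X t)] [∀ t, MeasurableSpace (Y t)]
    (hY : ∀ t, (∀ s ≤ t, Nonempty (X s)) → Nonempty (Y t))
    (hW : ∀ w, w ∈ W) :
    ∃ g : ∀ t : ℕ, (∀ s : Fin t, X s.val × Y s.val) → X t → Y t,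
      (∀ t : ℕ, UniversallyMeasurable
        fun q : (∀ s : Fin t, X s.val × Y s.val) × X t => g t q.1 q.2) ∧ WinningForPL W g := by
  have hg (t : ℕ) (v : ∀ s : Fin t, X s.val × Y s.val) (x : X t) : Nonempty (Y t) := by
    refine hY t fun s hs => ?_
    obtain rfl | hs := hs.eq_or_lt
    exacts [⟨x⟩, ⟨(v ⟨s, hs⟩).1⟩]
  refine ⟨fun t v x => (hg t v x).some, fun t μ _ => ?_, fun x y _ => hW _⟩
  by_cases ht : Nonempty (Y t)
  · exact (measurable_const (a := ht.some)).nullMeasurable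
  · have : IsEmpty ((∀ s : Fin t, X s.val × Y s.val) × X t) :=
      ⟨fun q => ht (hg t q.1 q.2)⟩
    exact (measurable_of_empty _).nullMeasurable

end EmptyMoves

/-- **Theorem B.1 (measurable Gale-Stewart strategies).** Let `𝒳_t` be Polish spaces and `𝒴_t`
countable discrete spaces. If the set `𝖶` of winning sequences for `P_L` is finitely decidable
and coanalytic, then either `P_A` has a winning strategy, or `P_L` has a winning strategy all of
whose maps are universally measurable. -/
theorem measurable_gale_stewart
    [∀ t, TopologicalSpace (X t)] [∀ t, PolishSpace (X t)]
    [∀ t, MeasurableSpace (X t)] [∀ t, BorelSpace (X t)]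
    [∀ t, TopologicalSpace (Y t)] [∀ t, DiscreteTopology (Y t)] [∀ t, Countable (Y t)]
    [∀ t, MeasurableSpace (Y t)] [∀ t, BorelSpace (Y t)]
    (W : Set (∀ t : ℕ, X t × Y t))
    (hfd : FinitelyDecidable W) (hco : MeasureTheory.AnalyticSet Wᶜ) :
    (∃ f : ∀ t : ℕ, (∀ s : Fin t, X s.val × Y s.val) → X t, WinningForPA W f) ∨
    (∃ g : ∀ t : ℕ, (∀ s : Fin t, X s.val × Y s.val) → X t → Y t,
      (∀ t : ℕ, UniversallyMeasurable
        fun q : (∀ s : Fin t, X s.val × Y s.val) × X t => g t q.1 q.2) ∧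
      WinningForPL W g) := by
  classical
  by_cases hA : ∃ n, IsEmpty (Y n) ∧ ∀ t ≤ n, Nonempty (X t)
  · obtain ⟨n, hYn, hX⟩ := hA
    exact .inl (exists_winningForPA_of_isEmpty hYn hX)
  have hY (t : ℕ) (hX : ∀ s ≤ t, Nonempty (X s)) : Nonempty (Y t) := by
    by_contra ht
    exact hA ⟨t, not_nonempty_iff.1 ht, hX⟩
  obtain hne | hne := Wᶜ.eq_empty_or_nonempty
  · rw [Set.compl_empty_iff] at hne
    exact .inr (exists_constant_winningForPL hY fun w => hne ▸ Set.mem_univ w)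
  have : ∀ t, Nonempty (X t) := fun t => ⟨(hne.some t).1⟩
  have : ∀ t, Nonempty (Y t) := fun t => ⟨(hne.some t).2⟩
  obtain ⟨C, hC⟩ := GameCoding.exists_range_escape_eq hco hne
  by_cases h₀ : ∃ v : Position X Y 0, C.rank 0 v = ⊤
  · exact .inl (GameCoding.exists_winningForPA hfd hC h₀.choose_spec)
  · exact .inr ⟨C.minimalReply, C.universallyMeasurable_minimalReply,
      GameCoding.winningForPL_minimalReply hC fun v hv => h₀ ⟨v, hv⟩⟩
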